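/- Let ℓ ≥ j ≥ 3 be integers and let s be an integer with 0 ≤ s < 2^{j-1} such that s ≠ 0 and s is not of the form 4^a (8b + 1) for any nonnegative integers a, b. Then for all integers n ≥ 0, PD_{2^ℓ}(2^j n + 2s) ≡ 0 (mod 2). -/

import Mathlib

/-- `PD k n` is the number of partitions of `n` with designated summands whose parts are
not divisible by `k`: the sum over partitions of `n` with no part divisible by `k` of the
product of the multiplicities of the distinct part sizes. -/
def PD (k n : ℕ) : ℕ :=
  ∑ p : n.Partition,
    if ∀ s ∈ p.parts, ¬ k ∣ s then ∏ s ∈ p.parts.toFinset, p.parts.count s else 0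

open PowerSeries

/-- On pairs of odd natural numbers, multiplication of `(x + y√-3) / 2` by the primitive cube root
of unity that keeps both coordinates odd, followed by taking absolute values of the coordinates. -/
def rotate (p : ℕ × ℕ) : ℕ × ℕ :=
  if (p.1 + p.2) % 4 = 2 then ((p.1 - 3 * p.2 + (3 * p.2 - p.1)) / 2, (p.1 + p.2) / 2)
  else ((p.1 + 3 * p.2) / 2, (p.1 - p.2 + (p.2 - p.1)) / 2)

theorem rotate_rotate {x y : ℕ} (hx : x % 2 = 1) (hy : y % 2 = 1) :
    rotate (rotate (x, y)) = (x, y) := by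
  unfold rotate
  ext <;> dsimp only <;> split_ifs <;> dsimp only at * <;> omega

theorem rotate_odd {x y : ℕ} (hx : x % 2 = 1) (hy : y % 2 = 1) :
    (rotate (x, y)).1 % 2 = 1 ∧ (rotate (x, y)).2 % 2 = 1 := by
  unfold rotate
  constructor <;> dsimp only <;> split_ifs <;> dsimp only at * <;> omega

theorem rotate_eq_self_iff {x y : ℕ} (hx : x % 2 = 1) (hy : y % 2 = 1) :
    (rotate (x, y)) = (x, y) ↔ x = y ∨ x = 3 * y := by
  unfold rotate
  split_ifs <;> simp only [Prod.mk.injEq] <;> omega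

theorem rotate_norm {x y : ℕ} (hx : x % 2 = 1) (hy : y % 2 = 1) :
    (rotate (x, y)).1 ^ 2 + 3 * (rotate (x, y)).2 ^ 2 = x ^ 2 + 3 * y ^ 2 := by
  unfold rotate
  dsimp only
  split_ifs
  · obtain ⟨u, hu⟩ : ∃ u : ℕ, u = (x - 3 * y + (3 * y - x)) / 2 := ⟨_, rfl⟩
    obtain ⟨v, hv⟩ : ∃ v : ℕ, v = (x + y) / 2 := ⟨_, rfl⟩
    dsimp only
    rw [← hu, ← hv]
    obtain h | h : (x = 3 * y + 2 * u ∧ v = 2 * y + u) ∨ (x + 2 * u = 3 * y ∧ 2 * v = x + y) := by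
      omega
    · obtain ⟨rfl, rfl⟩ := h; ring
    · zify at *; obtain ⟨h1, h2⟩ := h; grind
  · obtain ⟨u, hu⟩ : ∃ u : ℕ, u = (x + 3 * y) / 2 := ⟨_, rfl⟩
    obtain ⟨v, hv⟩ : ∃ v : ℕ, v = (x - y + (y - x)) / 2 := ⟨_, rfl⟩
    dsimp only
    rw [← hu, ← hv]
    obtain h | h : (x = y + 2 * v ∧ u = 2 * y + v) ∨ (y = x + 2 * v ∧ u = 2 * x + 3 * v) := by omega
    · obtain ⟨rfl, rfl⟩ := h; ring
    · obtain ⟨rfl, rfl⟩ := h; ring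

theorem card_eq_card_filter_add_card_filter (N : ℕ) (T : Finset (ℕ × ℕ))
    (hT : ∀ p, p ∈ T ↔ p.1 % 2 = 1 ∧ p.2 % 2 = 1 ∧ p.1 ^ 2 + 3 * p.2 ^ 2 = N) :
    (T.card : ZMod 2) = (T.filter fun p ↦ p.1 = p.2).card +
      (T.filter fun p ↦ p.1 = 3 * p.2).card := by
  have key : ∑ p ∈ T, (if p.1 = p.2 ∨ p.1 = 3 * p.2 then 0 else 1 : ZMod 2) = 0 := by
    refine Finset.sum_involution (fun p _ ↦ rotate p) ?_ ?_ ?_ ?_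
    · rintro ⟨x, y⟩ hp
      obtain ⟨hx, hy, -⟩ := (hT _).1 hp
      have h1 := rotate_eq_self_iff hx hy
      obtain ⟨hx', hy'⟩ := rotate_odd hx hy
      have h2 := rotate_eq_self_iff hx' hy'
      rw [Prod.mk.eta, rotate_rotate hx hy, eq_comm] at h2
      rw [if_congr (h2.symm.trans h1) rfl rfl]
      exact CharTwo.add_self_eq_zero _
    · rintro ⟨x, y⟩ hp h0 h
      obtain ⟨hx, hy, -⟩ := (hT _).1 hp
      exact h0 (if_pos ((rotate_eq_self_iff hx hy).1 h))
    · rintro ⟨x, y⟩ hp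
      obtain ⟨hx, hy, h⟩ := (hT _).1 hp
      exact (hT _).2 ⟨(rotate_odd hx hy).1, (rotate_odd hx hy).2, (rotate_norm hx hy).trans h⟩
    · rintro ⟨x, y⟩ hp
      obtain ⟨hx, hy, -⟩ := (hT _).1 hp
      exact rotate_rotate hx hy
  rw [Finset.card_eq_sum_ones, Finset.card_filter, Finset.card_filter]
  push_cast
  rw [← sub_eq_zero, ← Finset.sum_add_distrib, ← Finset.sum_sub_distrib]
  refine (Finset.sum_congr rfl ?_).trans key
  rintro ⟨x, y⟩ hp
  obtain ⟨hx, hy, -⟩ := (hT _).1 hp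
  by_cases h1 : x = y
  · simp [h1, show y ≠ 3 * y by omega]
  · by_cases h2 : x = 3 * y <;> simp [h1, h2, show 3 * y ≠ y by omega]

open Classical in
/-- The series `∑ X ^ (x ^ 2)` over odd natural numbers `x`, modulo 2. -/
noncomputable def oddSquares : (ZMod 2)⟦X⟧ :=
  .mk fun n ↦ if ∃ x, x % 2 = 1 ∧ x ^ 2 = n then 1 else 0

open Classical in
theorem coeff_expand_oddSquares (k : ℕ) (hk : k ≠ 0) (n : ℕ) : (expand k hk oddSquares).coeff n =
    if ∃ x, x % 2 = 1 ∧ k * x ^ 2 = n then 1 else 0 := by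
  rw [coeff_expand]
  by_cases h : k ∣ n
  · obtain ⟨m, rfl⟩ := h
    simp [oddSquares, hk]
  · rw [if_neg h, if_neg]
    rintro ⟨x, -, rfl⟩
    exact h (dvd_mul_right _ _)

theorem oddSquares_mul_expand_three : oddSquares * expand 3 (by simp) oddSquares =
    expand 4 (by simp) oddSquares + expand 12 (by simp) oddSquares := by
  classical
  ext N
  let T := ((Finset.range (N + 1)) ×ˢ (Finset.range (N + 1))).filter fun p ↦
    p.1 % 2 = 1 ∧ p.2 % 2 = 1 ∧ p.1 ^ 2 + 3 * p.2 ^ 2 = N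
  have hT (p) : p ∈ T ↔ p.1 % 2 = 1 ∧ p.2 % 2 = 1 ∧ p.1 ^ 2 + 3 * p.2 ^ 2 = N := by
    simp only [T, Finset.mem_filter, Finset.mem_product, Finset.mem_range, and_iff_right_iff_imp]
    rintro ⟨-, -, h⟩
    constructor <;> nlinarith
  have card_one (k : ℕ) (hk : k ≠ 0)
      (hkT : ∀ y, y % 2 = 1 → ((k * y, y) ∈ T ↔ (k ^ 2 + 3) * y ^ 2 = N)) :
      ((T.filter fun p ↦ p.1 = k * p.2).card : ZMod 2) =
        if ∃ x, x % 2 = 1 ∧ (k ^ 2 + 3) * x ^ 2 = N then 1 else 0 := by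
    split_ifs with h
    · obtain ⟨x, hx, hN⟩ := h
      have : T.filter (fun p ↦ p.1 = k * p.2) = {(k * x, x)} := by
        ext ⟨a, b⟩
        simp only [Finset.mem_filter, Finset.mem_singleton, Prod.mk.injEq]
        constructor
        · rintro ⟨h1, rfl⟩
          have hb := ((hT _).1 h1).2.1
          have := ((hkT b hb).1 h1).trans hN.symm
          have := Nat.pow_left_injective (two_ne_zero)
              (Nat.eq_of_mul_eq_mul_left (by positivity) this)
          simp_all
        · rintro ⟨rfl, rfl⟩
          exact ⟨(hkT _ hx).2 hN, rfl⟩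
      simp [this]
    · rw [Finset.card_eq_zero.2, Nat.cast_zero]
      refine Finset.filter_eq_empty_iff.2 ?_
      rintro ⟨a, b⟩ hp hab
      obtain rfl : a = k * b := hab
      have hb := ((hT _).1 hp).2.1
      exact h ⟨b, hb, (hkT b hb).1 hp⟩
  have h1 := card_one 1 one_ne_zero (fun y hy ↦ by rw [hT]; simp only; grind)
  have h3 := card_one 3 (by simp) (fun y hy ↦ by rw [hT]; simp only; grind)
  norm_num at h1 h3
  rw [map_add, coeff_expand_oddSquares, coeff_expand_oddSquares, ← h1, ← h3,
    ← card_eq_card_filter_add_card_filter N T hT, coeff_mul]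
  simp_rw [coeff_expand_oddSquares, oddSquares, coeff_mk, mul_ite, mul_one, mul_zero, ← ite_and]
  rw [← Finset.sum_filter, Finset.sum_const, nsmul_one]
  congr 1
  refine (Finset.card_nbij (fun p ↦ (p.1 ^ 2, 3 * p.2 ^ 2)) ?_ ?_ ?_).symm
  · rintro ⟨x, y⟩ hp
    obtain ⟨hx, hy, h⟩ := (hT _).1 hp
    exact Finset.mem_filter.2 ⟨Finset.HasAntidiagonal.mem_antidiagonal.2 h, ⟨y, hy, rfl⟩,
      ⟨x, hx, rfl⟩⟩
  · rintro ⟨x, y⟩ - ⟨x', y'⟩ - h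
    simpa using h
  · rintro ⟨a, b⟩ hp
    obtain ⟨h, ⟨y, hy, rfl⟩, ⟨x, hx, rfl⟩⟩ := Finset.mem_filter.1 (Finset.mem_coe.1 hp)
    exact ⟨(x, y), (hT _).2 ⟨hx, hy, Finset.HasAntidiagonal.mem_antidiagonal.1 h⟩, rfl⟩

instance charP_powerSeries_zmod_two : CharP (ZMod 2)⟦X⟧ 2 :=
  charP_of_injective_ringHom (C_injective (R := ZMod 2)) 2

theorem expand_two_pow (k : ℕ) (f : (ZMod 2)⟦X⟧) :
    expand (2 ^ k) (by positivity) f = f ^ 2 ^ k := by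
  have h := MvPowerSeries.map_iterateFrobenius_expand (σ := Unit) (R := ZMod 2) 2
    (by simp) k (f := f)
  have h2 : iterateFrobenius (ZMod 2) 2 k = RingHom.id _ := Subsingleton.elim _ _
  rw [h2, MvPowerSeries.map_id] at h
  exact h

open scoped PowerSeries.WithPiTopology in
theorem continuous_expand {R : Type*} [CommRing R] [TopologicalSpace R] (p : ℕ) (hp : p ≠ 0) :
    Continuous (expand p hp : R⟦X⟧ → R⟦X⟧) := by
  refine continuous_iff_continuousAt.2 fun f ↦ ?_
  rw [ContinuousAt, WithPiTopology.tendsto_iff_coeff_tendsto]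
  intro d
  simp_rw [coeff_expand]
  split_ifs
  · exact (WithPiTopology.continuous_coeff R _).continuousAt
  · exact tendsto_const_nhds

open scoped PowerSeries.WithPiTopology in
theorem hasProd_expand_pentagonalSeries {R : Type*} [CommRing R] [TopologicalSpace R]
    (p : ℕ) (hp : p ≠ 0) :
    HasProd (fun n ↦ (1 - X ^ (p * (n + 1)) : R⟦X⟧)) (expand p hp (pentagonalSeries R)) := by
  simpa [Function.comp_def, pow_mul] using
    (WithPiTopology.hasProd_one_sub_X_pow R).map (expand p hp) (continuous_expand p hp)

open scoped PowerSeries.WithPiTopology in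
theorem hasProd_expand_pentagonalSeries_ite {R : Type*} [CommRing R] [TopologicalSpace R]
    (k : ℕ) (hk : k ≠ 0) (m : ℕ) (hm : m ≠ 0) :
    HasProd (fun n ↦ (if k ∣ n + 1 then 1 - X ^ (m * (n + 1)) else 1 : R⟦X⟧))
      (expand (k * m) (mul_ne_zero hk hm) (pentagonalSeries R)) := by
  have hinj : Function.Injective fun n ↦ k * (n + 1) - 1 := by
    intro a b h
    have : k * (a + 1) = k * (b + 1) := by
      have := Nat.mul_pos (Nat.pos_of_ne_zero hk) a.succ_pos
      have := Nat.mul_pos (Nat.pos_of_ne_zero hk) b.succ_pos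
      simp only [Nat.succ_eq_add_one] at *
      omega
    simpa [hk] using this
  rw [← hinj.hasProd_iff]
  · convert hasProd_expand_pentagonalSeries (R := R) (k * m) (mul_ne_zero hk hm) using 2 with n
    have : k * (n + 1) - 1 + 1 = k * (n + 1) :=
        Nat.sub_add_cancel (Nat.mul_pos (Nat.pos_of_ne_zero hk) n.succ_pos)
    simp only [Function.comp_apply, this, dvd_mul_right, if_true]
    congr 2
    ring
  · intro n hn
    refine if_neg fun ⟨c, hc⟩ ↦ hn ⟨c - 1, ?_⟩
    have : c ≠ 0 := by rintro rfl; simp at hc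
    dsimp only
    rw [Nat.sub_add_cancel (Nat.pos_of_ne_zero this), ← hc, Nat.add_sub_cancel]

theorem exists_pentagonal_eq_iff (n : ℕ) :
    (∃ k : ℤ, pentagonal k = n) ↔ ∃ x : ℕ, x % 2 = 1 ∧ x % 3 ≠ 0 ∧ x ^ 2 = 24 * n + 1 := by
  constructor
  · rintro ⟨k, rfl⟩
    refine ⟨(6 * k - 1).natAbs, by omega, by omega, ?_⟩
    zify
    rw [sq_abs]
    linear_combination 12 * (-two_mul_natCast_pentagonal k)
  · rintro ⟨x, h2, h3, h⟩
    obtain ⟨k, hk⟩ : ∃ k : ℤ, (x : ℤ) = 6 * k - 1 ∨ (x : ℤ) = 1 - 6 * k := by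
      obtain h | h : x % 6 = 1 ∨ x % 6 = 5 := by omega
      · exact ⟨-((x : ℤ) / 6), by omega⟩
      · exact ⟨(x : ℤ) / 6 + 1, by omega⟩
    refine ⟨k, ?_⟩
    have h1 := two_mul_natCast_pentagonal k
    zify at h ⊢
    have h4 : (x : ℤ) ^ 2 = (6 * k - 1) ^ 2 := by rcases hk with hk | hk <;> rw [hk]; ring
    linarith

open Classical in
theorem coeff_pentagonalSeries_two (n : ℕ) : (pentagonalSeries (ZMod 2)).coeff n =
    if ∃ x : ℕ, x % 2 = 1 ∧ x % 3 ≠ 0 ∧ x ^ 2 = 24 * n + 1 then 1 else 0 := by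
  simp_rw [← exists_pentagonal_eq_iff]
  split_ifs with h
  · obtain ⟨k, rfl⟩ := h
    rw [coeff_pentagonalSeries_pentagonal]
    obtain h | h := Int.even_or_odd k <;> simp [Int.negOnePow_even, Int.negOnePow_odd, h]
  · exact coeff_pentagonalSeries_eq_zero _ (by simpa using h)

open Classical in
theorem coeff_X_mul_expand_pentagonalSeries (n : ℕ) :
    (X * expand 24 (by simp) (pentagonalSeries (ZMod 2))).coeff n =
    if n % 3 = 1 then oddSquares.coeff n else 0 := by
  have key : n % 3 = 1 ∧ (∃ x, x % 2 = 1 ∧ x ^ 2 = n) ↔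
      ∃ m, n = 24 * m + 1 ∧ ∃ x : ℕ, x % 2 = 1 ∧ x % 3 ≠ 0 ∧ x ^ 2 = 24 * m + 1 := by
    constructor
    · rintro ⟨hn, x, hx, rfl⟩
      have : x ^ 2 % 24 = (x % 24) ^ 2 % 24 := Nat.pow_mod _ _ _
      have h3 : x ^ 2 % 3 = (x % 3) ^ 2 % 3 := Nat.pow_mod _ _ _
      have h4 : x % 3 ≠ 0 := by intro h; rw [h] at h3; omega
      have h24 : x ^ 2 % 24 = 1 := by
        have : x % 24 < 24 := Nat.mod_lt _ (by simp)
        have : x % 24 % 2 = 1 := by omega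
        have : x % 24 % 3 ≠ 0 := by omega
        generalize x % 24 = r at *
        interval_cases r <;> simp_all
      exact ⟨x ^ 2 / 24, by omega, x, hx, h4, by omega⟩
    · rintro ⟨m, rfl, x, hx, hx3, h⟩
      exact ⟨by omega, x, hx, h⟩
  rw [oddSquares, coeff_mk, ← ite_and, if_congr key rfl rfl]
  rcases n with _ | n
  · simp
  · rw [coeff_succ_X_mul, coeff_expand]
    split_ifs with h1 h2 h2
    · obtain ⟨m, h, hx⟩ := h2
      obtain rfl : n = 24 * m := by omega
      rw [Nat.mul_div_cancel_left _ (by simp), coeff_pentagonalSeries_two, if_pos hx]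
    · obtain ⟨m, rfl⟩ := h1
      rw [Nat.mul_div_cancel_left _ (by simp), coeff_pentagonalSeries_two, if_neg]
      exact fun h ↦ h2 ⟨m, rfl, h⟩
    · obtain ⟨m, h, -⟩ := h2
      exact absurd ⟨m, by omega⟩ h1
    · rfl

theorem expand_injective {R : Type*} [CommRing R] (p : ℕ) (hp : p ≠ 0) :
    Function.Injective (expand p hp : R⟦X⟧ → R⟦X⟧) := by
  intro f g h
  ext n
  rw [← coeff_expand_mul p hp f, h, coeff_expand_mul]

theorem pentagonalSeries_ne_zero : pentagonalSeries (ZMod 2) ≠ 0 := by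
  intro h
  have := coeff_pentagonalSeries_pentagonal (ZMod 2) 0
  simp [h] at this

theorem pow_two_pow_injective (k : ℕ) : Function.Injective fun f : (ZMod 2)⟦X⟧ ↦ f ^ 2 ^ k :=
  iterateFrobenius_inj (ZMod 2)⟦X⟧ 2 k

theorem expand_mul_two_pow (m k : ℕ) (hm : m ≠ 0) (f : (ZMod 2)⟦X⟧) :
    expand (2 ^ k * m) (mul_ne_zero (pow_ne_zero k two_ne_zero) hm) f = expand m hm f ^ 2 ^ k := by
  rw [expand_mul _ (pow_ne_zero k two_ne_zero) _ hm, expand_two_pow]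

theorem expand_three_oddSquares :
    expand 3 (by simp) oddSquares =
      X ^ 3 * expand 3 (by simp) (pentagonalSeries (ZMod 2)) ^ 24 := by
  set f := pentagonalSeries (ZMod 2) with hf
  have h1 : (X * expand 24 (by simp) f) * expand 3 (by simp) oddSquares =
      expand 4 (by simp) (X * expand 24 (by simp) f) := by
    ext n
    have hrhs : (expand 4 (by simp) (X * expand 24 (by simp) f)).coeff n =
        if n % 3 = 1 then (oddSquares * expand 3 (by simp) oddSquares).coeff n else 0 := by
      rw [oddSquares_mul_expand_three, map_add, coeff_expand, coeff_expand, coeff_expand]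
      split_ifs with h1 h2 h3 h3
      · omega
      · rw [coeff_X_mul_expand_pentagonalSeries, if_pos (by omega), add_zero]
      · rw [coeff_X_mul_expand_pentagonalSeries, if_neg (by omega)]
      · omega
      · simp
      · rfl
    rw [hrhs, coeff_mul, coeff_mul]
    split_ifs with hn
    · refine Finset.sum_congr rfl ?_
      rintro ⟨a, b⟩ hab
      have hab := Finset.HasAntidiagonal.mem_antidiagonal.1 hab
      dsimp only at *
      rw [coeff_X_mul_expand_pentagonalSeries, coeff_expand (p := 3)]
      by_cases hb : 3 ∣ b
      · rw [if_pos (by omega)]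
      · simp [hb]
    · refine Finset.sum_eq_zero ?_
      rintro ⟨a, b⟩ hab
      have hab := Finset.HasAntidiagonal.mem_antidiagonal.1 hab
      dsimp only at *
      rw [coeff_X_mul_expand_pentagonalSeries, coeff_expand (p := 3)]
      by_cases hb : 3 ∣ b
      · rw [if_neg (by omega), zero_mul]
      · simp [hb]
  have h24 : expand 24 (by simp) f = expand 3 (by simp) f ^ 8 := expand_mul_two_pow 3 3 (by simp) f
  have h4 : expand 4 (by simp) (X * expand 24 (by simp) f) = (X * expand 24 (by simp) f) ^ 4 :=
    expand_two_pow 2 _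
  rw [h4, h24] at h1
  have hf3 : expand 3 (by simp) f ≠ 0 := fun h ↦ pentagonalSeries_ne_zero
    (expand_injective 3 (by simp) (h.trans (map_zero _).symm))
  refine mul_left_cancel₀ (mul_ne_zero X_ne_zero (pow_ne_zero 8 hf3)) (h1.trans ?_)
  ring

theorem pentagonalSeries_cubic :
    pentagonalSeries (ZMod 2) ^ 3 * expand 3 (by simp) (pentagonalSeries (ZMod 2)) ^ 3 =
      pentagonalSeries (ZMod 2) ^ 12 + X * expand 3 (by simp) (pentagonalSeries (ZMod 2)) ^ 12 := by
  have h0 : oddSquares = X * pentagonalSeries (ZMod 2) ^ 24 :=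
    expand_injective 3 (by simp) (by rw [expand_three_oddSquares]; simp)
  have h := oddSquares_mul_expand_three
  have h4 : expand 4 (by simp) oddSquares = oddSquares ^ 4 := expand_two_pow 2 _
  have h12 : expand 12 (by simp) oddSquares = expand 3 (by simp) oddSquares ^ 4 :=
    expand_mul_two_pow 3 2 (by simp) _
  rw [h4, h12, expand_three_oddSquares, h0] at h
  refine pow_two_pow_injective 3 (mul_left_cancel₀ (pow_ne_zero 4 X_ne_zero) ?_)
  dsimp only
  rw [add_pow_expChar_pow]
  linear_combination h

section GeneratingFunction

open scoped PowerSeries.WithPiTopology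

/-- The generating function of `PD k` modulo 2. -/
noncomputable def pdSeries (k : ℕ) : (ZMod 2)⟦X⟧ := .mk fun n ↦ (PD k n : ZMod 2)

theorem pdSeries_eq_genFun (k : ℕ) :
    pdSeries k = Nat.Partition.genFun fun i c ↦ if k ∣ i then (0 : ZMod 2) else c := by
  ext n
  rw [pdSeries, coeff_mk, Nat.Partition.coeff_genFun, PD, Nat.cast_sum]
  refine Finset.sum_congr rfl fun p _ ↦ ?_
  rw [Finsupp.prod, Multiset.toFinsupp_support]
  split_ifs with h
  · push_cast
    refine Finset.prod_congr rfl fun i hi ↦ ?_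
    rw [if_neg (h i (Multiset.mem_toFinset.1 hi)), Multiset.toFinsupp_apply]
  · push Not at h
    obtain ⟨i, hi, hk⟩ := h
    rw [Nat.cast_zero]
    exact (Finset.prod_eq_zero (i := i) (Multiset.mem_toFinset.2 hi) (by rw [if_pos hk])).symm

theorem one_add_tsum_natCast_smul_pow_mul {R : Type*} [CommRing R] [TopologicalSpace R]
    [IsTopologicalRing R] [T2Space R] (i : ℕ) :
    (1 + ∑' j : ℕ, ((j + 1 : ℕ) : R) • (X : R⟦X⟧) ^ ((i + 1) * (j + 1))) * (1 - X ^ (i + 1)) ^ 2 =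
      1 - X ^ (i + 1) + X ^ (2 * (i + 1)) := by
  set q : R⟦X⟧ := X ^ (i + 1) with hq
  have hs := Nat.Partition.summable_genFun_term (fun _ c ↦ (c : R)) i
  set S := ∑' j : ℕ, ((j + 1 : ℕ) : R) • (X : R⟦X⟧) ^ ((i + 1) * (j + 1)) with hS
  have hq0 : constantCoeff q = 0 := by simp [q]
  have hg := WithPiTopology.summable_pow_of_constantCoeff_eq_zero hq0
  have hgeom := WithPiTopology.one_sub_mul_tsum_pow_of_constantCoeff_eq_zero hq0
  have key : S = q + (q * S + q * (q * ∑' j, q ^ j)) := by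
    rw [← hg.tsum_mul_left, ← (hg.mul_left q).tsum_mul_left, hS, ← hs.tsum_mul_left,
      ← (hs.mul_left q).tsum_add ((hg.mul_left q).mul_left q), hs.tsum_eq_zero_add]
    congr 1
    · simp [hq]
    · refine tsum_congr fun j ↦ ?_
      simp only [smul_eq_C_mul, map_natCast, hq, ← pow_mul]
      push_cast
      ring
  rw [mul_comm 2, pow_mul, ← hq]
  linear_combination (1 - q) * key + q ^ 2 * hgeom

theorem pdSeries_mul (k : ℕ) (hk : k ≠ 0) :
    pdSeries k * pentagonalSeries (ZMod 2) ^ 3 * expand (k * 3) (by simp [hk])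
      (pentagonalSeries (ZMod 2)) =
      expand 3 (by simp) (pentagonalSeries (ZMod 2)) * expand k hk
        (pentagonalSeries (ZMod 2)) ^ 3 := by
  have hG := pdSeries_eq_genFun k ▸
    Nat.Partition.hasProd_genFun fun i c ↦ if k ∣ i then (0 : ZMod 2) else c
  have h1 := WithPiTopology.hasProd_one_sub_X_pow (ZMod 2)
  have h3 := hasProd_expand_pentagonalSeries (R := ZMod 2) 3 (by simp)
  have hk1 := hasProd_expand_pentagonalSeries_ite (R := ZMod 2) k hk 1 one_ne_zero
  have hk3 := hasProd_expand_pentagonalSeries_ite (R := ZMod 2) k hk 3 (by simp)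
  have hL := (hG.mul ((h1.mul h1).mul h1)).mul hk3
  have hR := h3.mul ((hk1.mul hk1).mul hk1)
  simp only [mul_one, ← pow_three'] at hL hR
  refine hL.unique (hR.congr_fun fun n ↦ ?_)
  have h2 : (2 : (ZMod 2)⟦X⟧) = 0 := CharTwo.two_eq_zero
  split_ifs with h
  · simp
    ring
  · have := one_add_tsum_natCast_smul_pow_mul (R := ZMod 2) n
    rw [mul_comm 2, pow_mul] at this
    rw [mul_comm 3, pow_mul]
    linear_combination (1 - X ^ (n + 1)) * this + (X ^ (n + 1) * (X ^ (n + 1) - 1)) * h2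

end GeneratingFunction

/-- The series `∏ (1 - X ^ n) ^ 3 / (1 - X ^ (3 * n))` modulo 2. -/
noncomputable def cubicQuotient : (ZMod 2)⟦X⟧ :=
  pentagonalSeries (ZMod 2) ^ 3 * (expand 3 (by simp) (pentagonalSeries (ZMod 2)))⁻¹

theorem expand_three_pentagonalSeries_ne_zero :
    expand 3 (by simp) (pentagonalSeries (ZMod 2)) ≠ 0 :=
  fun h ↦ pentagonalSeries_ne_zero (expand_injective 3 (by simp) (h.trans (map_zero _).symm))

theorem constantCoeff_pentagonalSeries : constantCoeff (pentagonalSeries (ZMod 2)) = 1 := by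
  simpa [pentagonal] using coeff_pentagonalSeries_pentagonal (ZMod 2) 0

theorem cubicQuotient_mul : cubicQuotient * expand 3 (by simp) (pentagonalSeries (ZMod 2)) =
    pentagonalSeries (ZMod 2) ^ 3 := by
  rw [cubicQuotient, mul_assoc, PowerSeries.inv_mul_cancel, mul_one]
  simp [constantCoeff_pentagonalSeries]

theorem cubicQuotient_mul_inv : cubicQuotient * cubicQuotient⁻¹ = 1 := by
  refine PowerSeries.mul_inv_cancel _ ?_
  simp [cubicQuotient, constantCoeff_pentagonalSeries]

theorem cubicQuotient_eq : cubicQuotient =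
    cubicQuotient ^ 4 + X * expand 3 (by simp) (pentagonalSeries (ZMod 2)) ^ 8 := by
  refine mul_left_cancel₀ (pow_ne_zero 4 expand_three_pentagonalSeries_ne_zero) ?_
  have h := pentagonalSeries_cubic
  rw [show pentagonalSeries (ZMod 2) ^ 12 = (pentagonalSeries (ZMod 2) ^ 3) ^ 4 by ring,
    ← cubicQuotient_mul] at h
  linear_combination h

theorem pdSeries_two_pow (ℓ : ℕ) (hℓ : ℓ ≠ 0) : pdSeries (2 ^ ℓ) =
    (cubicQuotient ^ 2 ^ (ℓ - 1) * cubicQuotient) ^ 2 + X * (cubicQuotient ^ 2 ^ (ℓ - 1) *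
      (expand 3 (by simp) (pentagonalSeries (ZMod 2)) ^ 4 * cubicQuotient⁻¹)) ^ 2 := by
  obtain ⟨m, rfl⟩ := Nat.exists_eq_add_one_of_ne_zero hℓ
  have h := pdSeries_mul (2 ^ (m + 1)) (by positivity)
  rw [expand_mul_two_pow 3 _ (by simp), expand_two_pow, ← cubicQuotient_mul, pow_right_comm,
    ← cubicQuotient_mul] at h
  have hne := expand_three_pentagonalSeries_ne_zero
  have hA := left_ne_zero_of_mul (cubicQuotient_mul_inv ▸ one_ne_zero)
  have h' : pdSeries (2 ^ (m + 1)) * cubicQuotient = cubicQuotient ^ 2 ^ (m + 1) := by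
    refine mul_right_cancel₀ (mul_ne_zero hne (pow_ne_zero (2 ^ (m + 1)) hne)) ?_
    linear_combination h
  refine mul_right_cancel₀ hA (h'.trans ?_)
  rw [Nat.add_sub_cancel, pow_succ 2 m, pow_mul]
  linear_combination (cubicQuotient ^ 2 ^ m) ^ 2 * cubicQuotient⁻¹ * cubicQuotient_eq +
    (cubicQuotient ^ 2 ^ m) ^ 2 * (-1 + cubicQuotient ^ 3 - X *
      expand 3 (by simp) (pentagonalSeries (ZMod 2)) ^ 8 * cubicQuotient⁻¹) * cubicQuotient_mul_inv

theorem coeff_cubicQuotient_eq_zero (n : ℕ) (h0 : n ≠ 0)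
    (hn : ¬ ∃ a b : ℕ, n = 4 ^ a * (8 * b + 1)) :
    coeff n cubicQuotient = 0 := by
  induction n using Nat.strong_induction_on with
  | _ n ih =>
    have h4 (f : (ZMod 2)⟦X⟧) : f ^ 4 = expand 4 (by simp) f := (expand_two_pow 2 f).symm
    have h8 (f : (ZMod 2)⟦X⟧) : f ^ 8 = expand 8 (by simp) f := (expand_two_pow 3 f).symm
    rw [cubicQuotient_eq, map_add, h4, h8, coeff_expand]
    obtain ⟨m, rfl⟩ := Nat.exists_eq_add_one_of_ne_zero h0
    rw [coeff_succ_X_mul, coeff_expand, if_neg (c := 8 ∣ m), add_zero]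
    · split_ifs with h
      · obtain ⟨r, hr⟩ := h
        rw [hr, Nat.mul_div_cancel_left _ (by simp)]
        refine ih r (by omega) (by omega) ?_
        rintro ⟨a, b, rfl⟩
        exact hn ⟨a + 1, b, by rw [hr]; ring⟩
      · rfl
    · rintro ⟨r, rfl⟩
      exact hn ⟨0, r, by simp⟩

theorem eq_four_pow_mul_of_mod_two_pow (i a b : ℕ) (h : 4 ^ a * (8 * b + 1) % 2 ^ i ≠ 0) :
    ∃ c, 4 ^ a * (8 * b + 1) % 2 ^ i = 4 ^ a * (8 * c + 1) := by
  rw [show 4 = 2 ^ 2 from rfl, ← pow_mul] at *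
  obtain hi | hi := le_or_gt i (2 * a)
  · exact absurd (Nat.mod_eq_zero_of_dvd ((pow_dvd_pow 2 hi).mul_right _)) h
  obtain ⟨r, rfl⟩ := Nat.exists_eq_add_of_lt hi
  rw [add_assoc, pow_add, Nat.mul_mod_mul_left]
  simp only [mul_right_inj' (pow_ne_zero (2 * a) two_ne_zero)]
  match r with
  | 0 => exact ⟨0, by norm_num; omega⟩
  | 1 => exact ⟨0, by norm_num; omega⟩
  | r + 2 =>
    refine ⟨b % 2 ^ r, ?_⟩
    rw [show 2 ^ (r + 2 + 1) = 8 * 2 ^ r by ring, Nat.mod_mul, show (8 * b + 1) / 8 = b by omega]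
    omega

theorem stmt_5 (j ℓ s : ℕ) (hj : 3 ≤ j) (hℓ : j ≤ ℓ) (hs : s < 2 ^ (j - 1))
    (hs0 : s ≠ 0) (hform : ¬ ∃ a b : ℕ, s = 4 ^ a * (8 * b + 1)) :
    ∀ n : ℕ, PD (2 ^ ℓ) (2 ^ j * n + 2 * s) % 2 = 0 := by
  intro n
  rw [← Nat.dvd_iff_mod_eq_zero, ← ZMod.natCast_eq_zero_iff]
  have h2 (f : (ZMod 2)⟦X⟧) : f ^ 2 = expand 2 (by simp) f := (expand_two_pow 1 f).symm
  obtain ⟨i, rfl⟩ : ∃ i, j = i + 1 := ⟨j - 1, by omega⟩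
  rw [Nat.add_sub_cancel] at hs
  set m := 2 ^ i * n + s with hm
  have h : (PD (2 ^ ℓ) (2 * m) : ZMod 2) = coeff (2 * m) (pdSeries (2 ^ ℓ)) := by
    rw [pdSeries, coeff_mk]
  rw [show 2 ^ (i + 1) * n + 2 * s = 2 * m by rw [hm]; ring, h, pdSeries_two_pow ℓ (by omega),
    map_add, h2, h2, coeff_expand_mul]
  have hX (f : (ZMod 2)⟦X⟧) : coeff (2 * m) (X * expand 2 (by simp) f) = 0 := by
    obtain ⟨r, hr⟩ : ∃ r, m = r + 1 := Nat.exists_eq_add_one_of_ne_zero (by omega)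
    rw [show 2 * m = 2 * r + 1 + 1 by omega, coeff_succ_X_mul, coeff_expand_of_not_dvd]
    omega
  rw [hX, add_zero, ← expand_two_pow, coeff_mul]
  refine Finset.sum_eq_zero ?_
  rintro ⟨a, b⟩ hab
  replace hab : a + b = m := Finset.HasAntidiagonal.mem_antidiagonal.1 hab
  dsimp only
  by_cases ha : 2 ^ (ℓ - 1) ∣ a
  · have hb : b % 2 ^ i = s := by
      obtain ⟨c, rfl⟩ : 2 ^ i ∣ a := (pow_dvd_pow 2 (by omega)).trans ha
      have := congrArg (· % 2 ^ i) hab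
      simpa [hm, Nat.mod_eq_of_lt hs] using this
    rw [coeff_cubicQuotient_eq_zero b, mul_zero]
    · rintro rfl
      exact hs0 (by simpa using hb.symm)
    · rintro ⟨u, v, rfl⟩
      obtain ⟨c, hc⟩ := eq_four_pow_mul_of_mod_two_pow i u v (hb ▸ hs0)
      exact hform ⟨u, c, hb.symm.trans hc⟩
  · rw [coeff_expand_of_not_dvd _ _ _ ha, zero_mul]
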